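/- Let μ and ν be Borel probability measures on ℝ, and for a probability measure ρ on ℝ let F_ρ(z) = 1/G_ρ(z) for z ∈ ℂ⁺ (which is well defined and maps ℂ⁺ into ℂ⁺). Then there exist unique Borel probability measures ζ₁ and ζ₂ on ℝ such that for all z ∈ ℂ⁺: F_μ(F_{ζ₁}(z)) = F_ν(F_{ζ₂}(z)) = F_{ζ₁}(z) + F_{ζ₂}(z) − z. (Consequently the additive free convolution decomposes as μ ⊞ ν = μ ▷ ζ₁ = ν ▷ ζ₂ = ζ₁ ⊎ ζ₂, where ▷ is the additive monotone convolution and ⊎ the additive boolean convolution.) -/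

import Mathlib

open MeasureTheory

/-- The Cauchy transform `G_ρ(z) = ∫ 1/(z−t) dρ(t)` of a measure on `ℝ`. -/
noncomputable def cauchyTransform (ρ : Measure ℝ) (z : ℂ) : ℂ := ∫ t, (z - (t : ℂ))⁻¹ ∂ρ

/-- The reciprocal Cauchy transform `F_ρ(z) = 1/G_ρ(z)`. -/
noncomputable def reciprocalCauchyTransform (ρ : Measure ℝ) (z : ℂ) : ℂ :=
  (cauchyTransform ρ z)⁻¹

section Auxiliary

open Set Filter Topology Complex ComplexConjugate

lemma sub_ofReal_ne_zero {z : ℂ} (hz : z.im ≠ 0) (t : ℝ) : z - t ≠ 0 := fun h =>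
  hz (by simpa using congrArg Complex.im h)

lemma norm_inv_sub_ofReal_le {z : ℂ} (hz : z.im ≠ 0) (t : ℝ) :
    ‖(z - (t : ℂ))⁻¹‖ ≤ |z.im|⁻¹ := by
  rw [norm_inv]
  refine inv_anti₀ (abs_pos.2 hz) ?_
  simpa using Complex.abs_im_le_norm (z - t)

lemma measurable_inv_sub_ofReal (z : ℂ) : Measurable fun t : ℝ => (z - (t : ℂ))⁻¹ := by
  fun_prop

lemma neg_im_inv_sub_ofReal (z : ℂ) (t : ℝ) :
    -((z - (t : ℂ))⁻¹).im = z.im / normSq (z - t) := by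
  simp [Complex.inv_im, neg_div]

lemma cauchyTransform_conj (ρ : Measure ℝ) (z : ℂ) :
    cauchyTransform ρ (conj z) = conj (cauchyTransform ρ z) := by
  rw [cauchyTransform, cauchyTransform, ← integral_conj]
  simp

/-- The normalised resolvent `(z - t)⁻¹ F_ρ(z)` minus its mean `1`. -/
noncomputable def centeredResolvent (ρ : Measure ℝ) (z : ℂ) (t : ℝ) : ℂ :=
  (z - (t : ℂ))⁻¹ * reciprocalCauchyTransform ρ z - 1

lemma measurable_centeredResolvent (ρ : Measure ℝ) (z : ℂ) :
    Measurable (centeredResolvent ρ z) := by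
  unfold centeredResolvent; fun_prop

lemma norm_centeredResolvent_le (ρ : Measure ℝ) {z : ℂ} (hz : z.im ≠ 0) (t : ℝ) :
    ‖centeredResolvent ρ z t‖ ≤ |z.im|⁻¹ * ‖reciprocalCauchyTransform ρ z‖ + 1 := by
  refine (norm_sub_le _ _).trans ?_
  rw [norm_mul, norm_one]
  gcongr
  exact norm_inv_sub_ofReal_le hz t

/-- A holomorphic map `h` from the upper half-plane to its closure (recorded together with the
Schwarz–Pick inequality it satisfies) such that `h(w) = o(w)` at infinity in a cone around the
imaginary axis. -/
structure IsSublinearPick (h : ℂ → ℂ) : Prop where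
  im_nonneg : ∀ w : ℂ, 0 < w.im → 0 ≤ (h w).im
  differentiableAt : ∀ w : ℂ, 0 < w.im → DifferentiableAt ℂ h w
  schwarz_pick : ∀ w w' : ℂ, 0 < w.im → 0 < w'.im →
    ‖h w - h w'‖ ^ 2 * (w.im * w'.im) ≤ ‖w - w'‖ ^ 2 * ((h w).im * (h w').im)
  sublinear : ∀ ε > 0, ∃ R > 0, ∀ w : ℂ, R ≤ w.im → ‖w‖ ≤ 3 * w.im → ‖h w‖ ≤ ε * ‖w‖

lemma sq_norm_integral_mul_le {α : Type*} [MeasurableSpace α] {m : Measure α} {f g : α → ℂ}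
    (hf : MemLp f 2 m) (hg : MemLp g 2 m) :
    ‖∫ t, f t * g t ∂m‖ ^ 2 ≤ (∫ t, ‖f t‖ ^ 2 ∂m) * ∫ t, ‖g t‖ ^ 2 ∂m := by
  have h1 : ‖∫ t, f t * g t ∂m‖ ≤ ∫ t, ‖f t‖ * ‖g t‖ ∂m := by
    simpa using norm_integral_le_integral_norm (μ := m) fun t => f t * g t
  have h2 := integral_mul_norm_le_Lp_mul_Lq (μ := m) (f := f) (g := g) Real.HolderConjugate.two_two
    (by simpa using hf) (by simpa using hg)
  simp only [Real.rpow_two, ← Real.sqrt_eq_rpow] at h2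
  have h3 := h1.trans h2
  calc _ ≤ _ := pow_le_pow_left₀ (norm_nonneg _) h3 2
    _ = _ := by rw [mul_pow, Real.sq_sqrt (integral_nonneg fun _ => by positivity),
                  Real.sq_sqrt (integral_nonneg fun _ => by positivity)]

section CauchyTransform

variable (ρ : Measure ℝ) [IsProbabilityMeasure ρ]

lemma integrable_inv_sub_ofReal {z : ℂ} (hz : z.im ≠ 0) :
    Integrable (fun t : ℝ => (z - (t : ℂ))⁻¹) ρ :=
  .of_bound (measurable_inv_sub_ofReal z).aestronglyMeasurable |z.im|⁻¹
    (ae_of_all _ (norm_inv_sub_ofReal_le hz))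

lemma neg_im_cauchyTransform {z : ℂ} (hz : z.im ≠ 0) :
    -(cauchyTransform ρ z).im = ∫ t : ℝ, z.im / normSq (z - t) ∂ρ := by
  simp only [← neg_im_inv_sub_ofReal]
  rw [integral_neg, cauchyTransform]
  congr 1
  exact (integral_im (𝕜 := ℂ) (integrable_inv_sub_ofReal ρ hz)).symm

lemma integrable_im_div_normSq {z : ℂ} (hz : z.im ≠ 0) :
    Integrable (fun t : ℝ => z.im / normSq (z - t)) ρ := by
  simp only [← neg_im_inv_sub_ofReal]
  exact ((integrable_inv_sub_ofReal ρ hz).im).neg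

lemma cauchyTransform_im_neg {z : ℂ} (hz : 0 < z.im) : (cauchyTransform ρ z).im < 0 := by
  rw [← neg_pos, neg_im_cauchyTransform ρ hz.ne']
  have hpos : ∀ t : ℝ, 0 < z.im / normSq (z - t) := fun t =>
    div_pos hz (normSq_pos.2 (sub_ofReal_ne_zero hz.ne' t))
  rw [integral_pos_iff_support_of_nonneg (fun t => (hpos t).le)
    (integrable_im_div_normSq ρ hz.ne')]
  rw [Function.support_eq_univ fun t => (hpos t).ne']
  simp

lemma cauchyTransform_ne_zero {z : ℂ} (hz : 0 < z.im) : cauchyTransform ρ z ≠ 0 := fun h =>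
  (cauchyTransform_im_neg ρ hz).ne (by simp [h])

lemma norm_cauchyTransform_le {z : ℂ} (hz : 0 < z.im) : ‖cauchyTransform ρ z‖ ≤ z.im⁻¹ := by
  refine (norm_integral_le_of_norm_le_const (ae_of_all _
    (norm_inv_sub_ofReal_le hz.ne'))).trans ?_
  simp [abs_of_pos hz]

lemma differentiableAt_cauchyTransform {z : ℂ} (hz : 0 < z.im) :
    DifferentiableAt ℂ (cauchyTransform ρ) z := by
  have h : cauchyTransform ρ = fun w => -resolventTransform ρ w := by
    ext w
    rw [resolventTransform_apply, cauchyTransform, ← integral_neg]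
    refine integral_congr_ae (ae_of_all _ fun t => ?_)
    simp [resolvent, Ring.inverse_eq_inv', ← inv_neg]
  rw [h]
  refine (hasDerivAt_resolventTransform z ?_).differentiableAt.neg
  rintro ⟨x, -, rfl⟩
  simp at hz

lemma memLp_centeredResolvent {z : ℂ} (hz : z.im ≠ 0) (p : ENNReal) :
    MemLp (centeredResolvent ρ z) p ρ :=
  .of_bound (measurable_centeredResolvent ρ z).aestronglyMeasurable _
    (ae_of_all _ (norm_centeredResolvent_le ρ hz))

lemma reciprocal_sub_self_sub {z w : ℂ} (hz : z.im ≠ 0) (hw : w.im ≠ 0)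
    (hGz : cauchyTransform ρ z ≠ 0) (hGw : cauchyTransform ρ w ≠ 0) :
    (reciprocalCauchyTransform ρ z - z) - (reciprocalCauchyTransform ρ w - w) =
      (z - w) * ∫ t, centeredResolvent ρ z t * centeredResolvent ρ w t ∂ρ := by
  have key : ∀ t : ℝ, (z - w) * (centeredResolvent ρ z t * centeredResolvent ρ w t) =
      reciprocalCauchyTransform ρ z * reciprocalCauchyTransform ρ w *
        ((w - (t : ℂ))⁻¹ - (z - (t : ℂ))⁻¹) -
      (z - w) * ((z - (t : ℂ))⁻¹ * reciprocalCauchyTransform ρ z) -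
      (z - w) * ((w - (t : ℂ))⁻¹ * reciprocalCauchyTransform ρ w) + (z - w) := by
    intro t
    have h1 := sub_ofReal_ne_zero hz t
    have h2 := sub_ofReal_ne_zero hw t
    simp only [centeredResolvent]
    field_simp
    ring
  have iz := integrable_inv_sub_ofReal ρ hz
  have iw := integrable_inv_sub_ofReal ρ hw
  rw [← integral_const_mul]
  simp only [key]
  rw [integral_add (by fun_prop) (by fun_prop), integral_sub (by fun_prop) (by fun_prop),
    integral_sub (by fun_prop) (by fun_prop), integral_const_mul, integral_const_mul,
    integral_const_mul, integral_mul_const, integral_mul_const, integral_sub iw iz]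
  change _ = reciprocalCauchyTransform ρ z * reciprocalCauchyTransform ρ w *
    (cauchyTransform ρ w - cauchyTransform ρ z) -
    (z - w) * (cauchyTransform ρ z * reciprocalCauchyTransform ρ z) -
    (z - w) * (cauchyTransform ρ w * reciprocalCauchyTransform ρ w) + _
  simp only [integral_const, probReal_univ, one_smul, reciprocalCauchyTransform]
  field_simp
  ring

lemma im_reciprocal_sub_self {z : ℂ} (hz : 0 < z.im) :
    (reciprocalCauchyTransform ρ z - z).im =
      z.im * ∫ t, ‖centeredResolvent ρ z t‖ ^ 2 ∂ρ := by
  have hG := cauchyTransform_ne_zero ρ hz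
  have hF : reciprocalCauchyTransform ρ (conj z) = conj (reciprocalCauchyTransform ρ z) := by
    simp [reciprocalCauchyTransform, cauchyTransform_conj]
  have h := reciprocal_sub_self_sub ρ (z := z) (w := conj z) hz.ne' (by simpa using hz.ne') hG
    (by simpa [cauchyTransform_conj] using hG)
  have hk : ∀ t, centeredResolvent ρ z t * centeredResolvent ρ (conj z) t =
      ((‖centeredResolvent ρ z t‖ ^ 2 : ℝ) : ℂ) := fun t => by
    have : centeredResolvent ρ (conj z) t = conj (centeredResolvent ρ z t) := by
      simp [centeredResolvent, hF]
    rw [this, Complex.mul_conj, Complex.normSq_eq_norm_sq]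
  simp only [hk, integral_complex_ofReal] at h
  have h2 := congrArg Complex.im h
  simp [hF] at h2
  simp
  linarith

lemma tendsto_mul_cauchyTransform :
    Tendsto (fun w : ℂ => w * cauchyTransform ρ w)
      (comap Complex.im atTop ⊓ 𝓟 {w : ℂ | ‖w‖ ≤ 3 * w.im}) (𝓝 1) := by
  have hpos : ∀ᶠ w : ℂ in comap Complex.im atTop ⊓ 𝓟 {w : ℂ | ‖w‖ ≤ 3 * w.im}, 0 < w.im :=
    Filter.Eventually.filter_mono inf_le_left ((eventually_gt_atTop 0).comap _)
  have h3 : ∀ᶠ w : ℂ in comap Complex.im atTop ⊓ 𝓟 {w : ℂ | ‖w‖ ≤ 3 * w.im}, ‖w‖ ≤ 3 * w.im :=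
    Filter.Eventually.filter_mono inf_le_right (by simp)
  simp only [cauchyTransform, ← integral_const_mul]
  have h1 : (1 : ℂ) = ∫ _ : ℝ, (1 : ℂ) ∂ρ := by simp
  rw [h1]
  refine tendsto_integral_filter_of_dominated_convergence (fun _ => (3 : ℝ))
    (.of_forall fun w => by fun_prop) ?_ (by fun_prop) (ae_of_all _ fun t => ?_)
  · filter_upwards [hpos, h3] with w hw h3
    refine ae_of_all _ fun t => ?_
    have := norm_inv_sub_ofReal_le hw.ne' t
    rw [abs_of_pos hw] at this
    calc ‖w * (w - (t : ℂ))⁻¹‖ ≤ (3 * w.im) * w.im⁻¹ := by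
          rw [norm_mul]; gcongr
      _ = 3 := by field_simp
  · have h0 : Tendsto (fun w : ℂ => 1 + (t : ℂ) * (w - (t : ℂ))⁻¹)
        (comap Complex.im atTop ⊓ 𝓟 {w : ℂ | ‖w‖ ≤ 3 * w.im}) (𝓝 (1 + (t : ℂ) * 0)) := by
      refine tendsto_const_nhds.add (tendsto_const_nhds.mul ?_)
      have hi : Tendsto (fun w : ℂ => (w.im)⁻¹) (comap Complex.im atTop ⊓
          𝓟 {w : ℂ | ‖w‖ ≤ 3 * w.im}) (𝓝 0) :=
        (tendsto_inv_atTop_zero.comp tendsto_comap).mono_left inf_le_left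
      refine squeeze_zero_norm' ?_ hi
      filter_upwards [hpos] with w hw
      simpa [abs_of_pos hw] using norm_inv_sub_ofReal_le hw.ne' t
    simp only [mul_zero, add_zero] at h0
    refine h0.congr' ?_
    filter_upwards [hpos] with w hw
    have := sub_ofReal_ne_zero hw.ne' t
    field_simp
    ring

lemma isSublinearPick_reciprocal_sub_self :
    IsSublinearPick fun w => reciprocalCauchyTransform ρ w - w where
  im_nonneg w hw := by
    rw [im_reciprocal_sub_self ρ hw]
    have : 0 ≤ ∫ t, ‖centeredResolvent ρ w t‖ ^ 2 ∂ρ := integral_nonneg fun _ => by positivity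
    positivity
  differentiableAt w hw :=
    ((differentiableAt_cauchyTransform ρ hw).inv (cauchyTransform_ne_zero ρ hw)).sub
      differentiableAt_id
  schwarz_pick w w' hw hw' := by
    rw [reciprocal_sub_self_sub ρ hw.ne' hw'.ne' (cauchyTransform_ne_zero ρ hw)
      (cauchyTransform_ne_zero ρ hw'), im_reciprocal_sub_self ρ hw, im_reciprocal_sub_self ρ hw',
      norm_mul, mul_pow]
    have := sq_norm_integral_mul_le (memLp_centeredResolvent ρ hw.ne' 2)
      (memLp_centeredResolvent ρ hw'.ne' 2)
    calc _ ≤ ‖w - w'‖ ^ 2 * ((∫ t, ‖centeredResolvent ρ w t‖ ^ 2 ∂ρ) *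
          ∫ t, ‖centeredResolvent ρ w' t‖ ^ 2 ∂ρ) * (w.im * w'.im) := by gcongr
      _ = _ := by ring
  sublinear ε hε := by
    have h1 : Tendsto (fun w : ℂ => (w * cauchyTransform ρ w)⁻¹ - 1)
      (comap Complex.im atTop ⊓ 𝓟 {w : ℂ | ‖w‖ ≤ 3 * w.im}) (𝓝 0) := by
      simpa using ((tendsto_mul_cauchyTransform ρ).inv₀ one_ne_zero).sub_const 1
    have h2 := h1.norm.eventually_le_const (by simpa using hε)
    rw [eventually_inf_principal, eventually_comap] at h2
    obtain ⟨R, hR⟩ := h2.exists_forall_of_atTop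
    refine ⟨max R 1, by positivity, fun w hw hw3 => ?_⟩
    have h := hR w.im (le_of_max_le_left hw) w rfl hw3
    have hw0 : w ≠ 0 := by
      rintro rfl
      have := le_of_max_le_right hw
      simp at this
      linarith
    have : reciprocalCauchyTransform ρ w - w = ((w * cauchyTransform ρ w)⁻¹ - 1) * w := by
      rw [reciprocalCauchyTransform, mul_inv]
      field_simp
    rw [this, norm_mul]
    gcongr

end CauchyTransform

section StieltjesInversion

open scoped ENNReal NNReal BoundedContinuousFunction

lemma lintegral_mul_poisson (f : ℝ → ℝ≥0∞) (t : ℝ) {ε : ℝ} (hε : 0 < ε) :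
    ∫⁻ x, f x * ENNReal.ofReal (ε / ((x - t) ^ 2 + ε ^ 2)) =
      ∫⁻ u, f (t + ε * u) * ENNReal.ofReal ((1 + u ^ 2)⁻¹) := by
  have himg : (fun u : ℝ => t + ε * u) '' univ = univ := by
    rw [image_univ]
    exact Function.Surjective.range_eq fun x => ⟨(x - t) / ε, by field_simp; ring⟩
  have hinj : InjOn (fun u : ℝ => t + ε * u) univ := fun a _ b _ h => by
    simpa [hε.ne'] using h
  have hd : ∀ u ∈ (univ : Set ℝ), HasDerivWithinAt (fun u : ℝ => t + ε * u) ε univ u :=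
    fun u _ => by
      have : HasDerivAt (fun u : ℝ => t + ε * u) (ε * 1) u :=
        ((hasDerivAt_id u).const_mul ε).const_add t
      rw [mul_one] at this
      exact this.hasDerivWithinAt
  have h := lintegral_image_eq_lintegral_abs_deriv_mul MeasurableSet.univ hd hinj
    fun x => f x * ENNReal.ofReal (ε / ((x - t) ^ 2 + ε ^ 2))
  rw [himg] at h
  simp only [Measure.restrict_univ] at h
  rw [h]
  refine lintegral_congr fun u => ?_
  rw [mul_left_comm, ← ENNReal.ofReal_mul (abs_nonneg _), abs_of_pos hε]
  congr 2
  have : (1 + u ^ 2) ≠ 0 := by positivity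
  field_simp
  ring

lemma lintegral_poisson_eq (ρ : Measure ℝ) [IsProbabilityMeasure ρ] (x : ℝ) {ε : ℝ} (hε : 0 < ε) :
    ∫⁻ t, ENNReal.ofReal (ε / ((x - t) ^ 2 + ε ^ 2)) ∂ρ =
      ENNReal.ofReal (-(cauchyTransform ρ (x + ε * I)).im) := by
  have him : ((x : ℂ) + ε * I).im = ε := by simp
  have hint := integrable_im_div_normSq ρ (z := x + ε * I) (by simpa using hε.ne')
  have hsq : ∀ t : ℝ, normSq ((x : ℂ) + ε * I - t) = (x - t) ^ 2 + ε ^ 2 := fun t => by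
    simp [normSq_apply]; ring
  simp only [him, hsq] at hint
  rw [neg_im_cauchyTransform ρ (by simpa using hε.ne'),
    ofReal_integral_eq_lintegral_ofReal]
  · simp only [him, hsq]
  · simpa only [him, hsq] using hint
  · exact ae_of_all _ fun t => by simp only [him, hsq]; positivity

lemma lintegral_lintegral_poisson (ρ : Measure ℝ) [IsProbabilityMeasure ρ] (f : ℝ →ᵇ ℝ≥0)
    {ε : ℝ} (hε : 0 < ε) :
    ∫⁻ t, (∫⁻ u, (f (t + ε * u) : ℝ≥0∞) * ENNReal.ofReal ((1 + u ^ 2)⁻¹)) ∂ρ =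
      ∫⁻ x, (f x : ℝ≥0∞) * ENNReal.ofReal (-(cauchyTransform ρ (x + ε * I)).im) := by
  have hf : Measurable f := f.continuous.measurable
  simp only [← lintegral_mul_poisson (fun x => (f x : ℝ≥0∞)) _ hε]
  rw [lintegral_lintegral_swap (by fun_prop)]
  refine lintegral_congr fun x => ?_
  rw [lintegral_const_mul _ (by fun_prop), lintegral_poisson_eq ρ x hε]

lemma lintegral_inv_one_add_sq :
    ∫⁻ u : ℝ, ENNReal.ofReal ((1 + u ^ 2)⁻¹) = ENNReal.ofReal Real.pi := by
  rw [← integral_univ_inv_one_add_sq, ofReal_integral_eq_lintegral_ofReal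
    integrable_inv_one_add_sq (ae_of_all _ fun u => by positivity)]

lemma tendsto_lintegral_lintegral_poisson (ρ : Measure ℝ) [IsProbabilityMeasure ρ]
    (f : ℝ →ᵇ ℝ≥0) :
    Tendsto (fun ε : ℝ => ∫⁻ t, (∫⁻ u, (f (t + ε * u) : ℝ≥0∞) *
      ENNReal.ofReal ((1 + u ^ 2)⁻¹)) ∂ρ) (𝓝[>] 0)
      (𝓝 ((∫⁻ t, f t ∂ρ) * ENNReal.ofReal Real.pi)) := by
  have hf : Measurable f := f.continuous.measurable
  obtain ⟨C, hC⟩ : ∃ C : ℝ≥0, ∀ x, f x ≤ C := ⟨_, f.apply_le_nndist_zero⟩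
  have hb : ∀ t ε : ℝ, ∫⁻ u, (f (t + ε * u) : ℝ≥0∞) * ENNReal.ofReal ((1 + u ^ 2)⁻¹) ≤
      C * ENNReal.ofReal Real.pi := fun t ε => by
    rw [← lintegral_inv_one_add_sq, ← lintegral_const_mul _ (by fun_prop)]
    refine lintegral_mono fun u => ?_
    gcongr
    exact hC _
  rw [← lintegral_mul_const _ (by fun_prop)]
  refine tendsto_lintegral_filter_of_dominated_convergence (fun _ => C * ENNReal.ofReal Real.pi)
    (.of_forall fun ε => Measurable.lintegral_prod_right' (f := fun p : ℝ × ℝ =>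
      (f (p.1 + ε * p.2) : ℝ≥0∞) * ENNReal.ofReal ((1 + p.2 ^ 2)⁻¹)) (by fun_prop))
    (.of_forall fun ε => ae_of_all _ fun t => hb t ε)
    (by simp [ENNReal.mul_eq_top]) (ae_of_all _ fun t => ?_)
  rw [← lintegral_inv_one_add_sq, ← lintegral_const_mul _ (by fun_prop)]
  refine tendsto_lintegral_filter_of_dominated_convergence
    (fun u => C * ENNReal.ofReal ((1 + u ^ 2)⁻¹))
    (.of_forall fun ε => by fun_prop) (.of_forall fun ε => ae_of_all _ fun u => ?_) ?_
    (ae_of_all _ fun u => ?_)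
  · gcongr
    exact hC _
  · rw [lintegral_const_mul _ (by fun_prop), lintegral_inv_one_add_sq]
    simp [ENNReal.mul_eq_top]
  · refine ENNReal.Tendsto.mul_const ?_ (Or.inr ENNReal.ofReal_ne_top)
    refine ENNReal.tendsto_coe.2 ?_
    have : Continuous fun ε : ℝ => f (t + ε * u) := by fun_prop
    simpa using (this.tendsto 0).mono_left nhdsWithin_le_nhds

/-- The Cauchy transform determines a probability measure. -/
theorem eq_of_cauchyTransform_eq {ρ σ : Measure ℝ} [IsProbabilityMeasure ρ]
    [IsProbabilityMeasure σ]
    (h : ∀ z : ℂ, 0 < z.im → cauchyTransform ρ z = cauchyTransform σ z) : ρ = σ := by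
  refine ext_of_forall_lintegral_eq_of_IsFiniteMeasure fun f => ?_
  have h1 := tendsto_lintegral_lintegral_poisson ρ f
  have h2 := tendsto_lintegral_lintegral_poisson σ f
  have h3 := tendsto_nhds_unique_of_eventuallyEq h1 h2 (by
    filter_upwards [self_mem_nhdsWithin] with ε hε
    rw [lintegral_lintegral_poisson ρ f hε, lintegral_lintegral_poisson σ f hε]
    refine lintegral_congr fun x => ?_
    rw [h _ (by simpa using hε)])
  rwa [ENNReal.mul_left_inj (by simpa using Real.pi_pos) ENNReal.ofReal_ne_top] at h3

end StieltjesInversion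

section Nevanlinna

open scoped ENNReal NNReal BoundedContinuousFunction

/-- The Poisson kernel of the unit disc, as a function of the angle. -/
noncomputable def anglePoissonKernel (w : ℂ) (θ : ℝ) : ℝ :=
  (1 - ‖w‖ ^ 2) / ‖circleMap 0 1 θ - w‖ ^ 2

lemma one_sub_norm_le_norm_circleMap_sub (w : ℂ) (θ : ℝ) :
    1 - ‖w‖ ≤ ‖circleMap 0 1 θ - w‖ := by
  simpa using norm_sub_norm_le (circleMap 0 1 θ) w

lemma circleMap_sub_ne_zero {w : ℂ} (hw : ‖w‖ < 1) (θ : ℝ) : ‖circleMap 0 1 θ - w‖ ≠ 0 :=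
  ((sub_pos.2 hw).trans_le (one_sub_norm_le_norm_circleMap_sub w θ)).ne'

lemma continuous_anglePoissonKernel {w : ℂ} (hw : ‖w‖ < 1) :
    Continuous (anglePoissonKernel w) := by
  unfold anglePoissonKernel
  refine Continuous.div (by fun_prop) (by fun_prop) fun θ => ?_
  exact pow_ne_zero 2 (circleMap_sub_ne_zero hw θ)

lemma norm_anglePoissonKernel_le {w : ℂ} (hw : ‖w‖ < 1) (θ : ℝ) :
    ‖anglePoissonKernel w θ‖ ≤ (1 - ‖w‖ ^ 2) / (1 - ‖w‖) ^ 2 := by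
  have h1 : 0 ≤ 1 - ‖w‖ ^ 2 := by nlinarith [norm_nonneg w]
  rw [anglePoissonKernel, Real.norm_of_nonneg (by positivity)]
  have := one_sub_norm_le_norm_circleMap_sub w θ
  have h2 : 0 < 1 - ‖w‖ := sub_pos.2 hw
  gcongr

/-- Poisson's formula on the circle of radius `r < 1`, with the boundary values absorbed into a
probability measure. -/
lemma exists_poisson_measure_of_lt_one {v : ℂ → ℂ} (hv : DifferentiableOn ℂ v (Metric.ball 0 1))
    (him : ∀ w ∈ Metric.ball (0 : ℂ) 1, (v w).im < 0) {r : ℝ} (h0 : 0 ≤ r) (h1 : r < 1) :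
    ∃ σ : ProbabilityMeasure ℝ, (σ : Measure ℝ) (Icc 0 (2 * Real.pi))ᶜ = 0 ∧
      ∀ w : ℂ, ‖w‖ < 1 →
        ∫ θ, anglePoissonKernel w θ ∂(σ : Measure ℝ) = (v 0).im⁻¹ * (v (r * w)).im := by
  have hm : (v 0).im < 0 := him 0 (by simp)
  have hmaps : ∀ w : ℂ, ‖w‖ ≤ 1 → (r : ℂ) * w ∈ Metric.ball (0 : ℂ) 1 := fun w hw => by
    rw [mem_ball_zero_iff, norm_mul, Complex.norm_of_nonneg h0]
    nlinarith [norm_nonneg w]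
  have hcont : ContinuousOn (fun w : ℂ => v (r * w)) (Metric.closedBall 0 1) :=
    hv.continuousOn.comp (by fun_prop) fun w hw => hmaps w (by simpa using hw)
  have hvr : DiffContOnCl ℂ (fun w : ℂ => v (r * w)) (Metric.ball 0 1) :=
    ⟨hv.comp (by fun_prop) fun w hw => hmaps w (by simpa using (mem_ball_zero_iff.1 hw).le),
      by rwa [closure_ball _ one_ne_zero]⟩
  have hcirc : Continuous fun θ : ℝ => v (r * circleMap 0 1 θ) :=
    hcont.comp_continuous (by fun_prop) fun θ => by simp
  set p : ℝ → ℝ := fun θ => (2 * Real.pi)⁻¹ * ((v 0).im⁻¹ * (v (r * circleMap 0 1 θ)).im) with hp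
  have hpc : Continuous p :=
    continuous_const.mul (continuous_const.mul (Complex.continuous_im.comp hcirc))
  have hp0 : ∀ θ, 0 ≤ p θ := fun θ => by
    have := him _ (hmaps (circleMap 0 1 θ) (by simp))
    have h2 := mul_pos_of_neg_of_neg (inv_lt_zero.2 hm) this
    have := Real.pi_pos
    positivity
  have key : ∀ w : ℂ, ‖w‖ < 1 →
      ∫ θ in Ioc 0 (2 * Real.pi), p θ * anglePoissonKernel w θ =
        (v 0).im⁻¹ * (v (r * w)).im := by
    intro w hw
    have h := hvr.circleAverage_poissonKernel_smul (w := w) (by simpa using hw)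
    rw [Real.circleAverage_def, intervalIntegral.integral_of_le (by positivity)] at h
    have hfun : ∀ θ : ℝ, (poissonKernel 0 w • fun w : ℂ => v (r * w)) (circleMap 0 1 θ) =
        (anglePoissonKernel w θ : ℂ) * v (r * circleMap 0 1 θ) := fun θ => by
      simp [poissonKernel, anglePoissonKernel]
    simp only [hfun] at h
    have hint : Integrable (fun θ => (anglePoissonKernel w θ : ℂ) * v (r * circleMap 0 1 θ))
        (volume.restrict (Ioc 0 (2 * Real.pi))) := by
      have hk := (Complex.continuous_ofReal.comp (continuous_anglePoissonKernel hw)).mul hcirc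
      exact hk.integrableOn_Icc.mono_set Ioc_subset_Icc_self
    have h2 := congrArg Complex.im h
    rw [Complex.smul_im] at h2
    have h3 := integral_im (𝕜 := ℂ) hint
    change _ = (∫ θ in Ioc 0 (2 * Real.pi), (anglePoissonKernel w θ : ℂ) *
      v (r * circleMap 0 1 θ)).im at h3
    rw [← h3] at h2
    simp only [RCLike.im_eq_complex_im, Complex.im_ofReal_mul] at h2
    rw [← h2, smul_eq_mul, ← mul_assoc, ← integral_const_mul]
    refine integral_congr_ae (ae_of_all _ fun θ => ?_)
    simp only [hp]
    ring
  set σ : Measure ℝ := (volume.restrict (Ioc 0 (2 * Real.pi))).withDensity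
    fun θ => ENNReal.ofReal (p θ) with hσ
  have hprob : IsProbabilityMeasure σ := by
    constructor
    have h := key 0 (by simp)
    simp only [anglePoissonKernel] at h
    simp only [norm_zero, sub_zero, norm_circleMap_zero, abs_one, mul_zero,
      inv_mul_cancel₀ hm.ne] at h
    norm_num at h
    rw [hσ, withDensity_apply _ MeasurableSet.univ, Measure.restrict_univ,
      ← ofReal_integral_eq_lintegral_ofReal, h, ENNReal.ofReal_one]
    · exact hpc.integrableOn_Icc.mono_set Ioc_subset_Icc_self
    · exact ae_of_all _ hp0
  refine ⟨⟨σ, hprob⟩, ?_, fun w hw => ?_⟩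
  · refine withDensity_absolutelyContinuous _ _ ?_
    rw [Measure.restrict_apply measurableSet_Icc.compl]
    convert measure_empty (μ := (volume : Measure ℝ))
    ext θ
    simp only [mem_inter_iff, mem_compl_iff, mem_Icc, mem_Ioc, mem_empty_iff_false, iff_false]
    grind
  · rw [← key w hw]
    change ∫ θ, anglePoissonKernel w θ ∂σ = _
    rw [hσ, integral_withDensity_eq_integral_toReal_smul (by fun_prop) (by simp)]
    refine integral_congr_ae (ae_of_all _ fun θ => ?_)
    simp [ENNReal.toReal_ofReal (hp0 θ)]

/-- Herglotz representation of a harmonic function of constant sign on the unit disc. -/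
lemma exists_poisson_measure {v : ℂ → ℂ} (hv : DifferentiableOn ℂ v (Metric.ball 0 1))
    (him : ∀ w ∈ Metric.ball (0 : ℂ) 1, (v w).im < 0) :
    ∃ σ : ProbabilityMeasure ℝ, ∀ w : ℂ, ‖w‖ < 1 →
        ∫ θ, anglePoissonKernel w θ ∂(σ : Measure ℝ) = (v 0).im⁻¹ * (v w).im := by
  have hr : ∀ n : ℕ, 0 ≤ (n : ℝ) / (n + 1) ∧ (n : ℝ) / (n + 1) < 1 := fun n =>
    ⟨by positivity, by rw [div_lt_one (by positivity)]; linarith⟩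
  choose σ hσ0 hσ using fun n => exists_poisson_measure_of_lt_one hv him (hr n).1 (hr n).2
  have htight : IsTightMeasureSet {((μ : ProbabilityMeasure ℝ) : Measure ℝ) | μ ∈ range σ} := by
    rw [isTightMeasureSet_iff_exists_isCompact_measure_compl_le]
    intro ε _
    refine ⟨Icc 0 (2 * Real.pi), isCompact_Icc, ?_⟩
    rintro _ ⟨_, ⟨n, rfl⟩, rfl⟩
    simp [hσ0 n]
  have hK := isCompact_closure_of_isTightMeasureSet htight
  have hle : ((Ultrafilter.of (atTop : Filter ℕ)).map σ : Filter (ProbabilityMeasure ℝ)) ≤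
      𝓟 (closure (range σ)) := by
    rw [le_principal_iff]
    exact Filter.mem_map.2 (Filter.univ_mem' fun n => subset_closure (mem_range_self n))
  obtain ⟨τ, -, hτ⟩ := hK.ultrafilter_le_nhds _ hle
  refine ⟨τ, fun w hw => ?_⟩
  have hτ' : Tendsto σ (Ultrafilter.of (atTop : Filter ℕ)) (𝓝 τ) := hτ
  rw [ProbabilityMeasure.tendsto_iff_forall_integral_tendsto] at hτ'
  have h1 := hτ' (BoundedContinuousFunction.ofNormedAddCommGroup (anglePoissonKernel w)
    (continuous_anglePoissonKernel hw) _ (norm_anglePoissonKernel_le hw))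
  simp only [BoundedContinuousFunction.coe_ofNormedAddCommGroup, hσ _ w hw] at h1
  refine tendsto_nhds_unique h1 (Tendsto.mono_left ?_ (Ultrafilter.of_le _))
  have hc : ContinuousAt v w := (hv.differentiableAt
    (Metric.isOpen_ball.mem_nhds (by simpa using hw))).continuousAt
  have h2 : Tendsto (fun n : ℕ => (((n : ℝ) / (n + 1) : ℝ) : ℂ) * w) atTop (𝓝 w) := by
    have := (Complex.continuous_ofReal.tendsto _).comp (tendsto_natCast_div_add_atTop (1 : ℝ))
    simpa using this.mul_const w
  exact ((Complex.continuous_im.tendsto _).comp (hc.tendsto.comp h2)).const_mul _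

lemma circleMap_eq_halfAngle (θ : ℝ) :
    circleMap 0 1 θ = ((Real.cos (θ / 2) : ℂ) + Real.sin (θ / 2) * I) ^ 2 := by
  have : (Real.cos (θ / 2) : ℂ) + Real.sin (θ / 2) * I = Complex.exp ((θ / 2 : ℝ) * I) := by
    rw [Complex.exp_mul_I]; simp
  rw [this, ← Complex.exp_nat_mul]
  simp only [circleMap, ofReal_one, one_mul, zero_add]
  congr 1
  push_cast
  ring

lemma anglePoissonKernel_cayley {z : ℂ} (hz : 0 < z.im) (θ : ℝ) :
    anglePoissonKernel ((z - I) / (z + I)) θ =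
      z.im / normSq (z * Real.sin (θ / 2) + Real.cos (θ / 2)) := by
  set c := Real.cos (θ / 2)
  set s := Real.sin (θ / 2)
  have hcs : c ^ 2 + s ^ 2 = 1 := Real.cos_sq_add_sin_sq _
  have hcs' : (c : ℂ) ^ 2 + (s : ℂ) ^ 2 = 1 := by exact_mod_cast hcs
  have hzI : z + I ≠ 0 := fun h => by
    have := congrArg Complex.im h
    simp at this
    linarith
  have hN : 0 < normSq (z + I) := normSq_pos.2 hzI
  have e1 : 1 - ‖(z - I) / (z + I)‖ ^ 2 = 4 * z.im / normSq (z + I) := by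
    rw [← Complex.normSq_eq_norm_sq, map_div₀]
    field_simp
    simp [normSq_apply]
    ring
  have hu : ((c : ℂ) + s * I) * (c - s * I) = 1 := by
    linear_combination hcs' - (s : ℂ) ^ 2 * I_sq
  have e2 : circleMap 0 1 θ - (z - I) / (z + I) =
      2 * I * ((c : ℂ) + s * I) * (z * s + c) / (z + I) := by
    rw [circleMap_eq_halfAngle, eq_div_iff hzI, sub_mul, div_mul_cancel₀ _ hzI]
    change ((c : ℂ) + s * I) ^ 2 * (z + I) - (z - I) = 2 * I * ((c : ℂ) + s * I) * (z * s + c)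
    have : (z + I) * ((c : ℂ) + s * I) - (z - I) * (c - s * I) = 2 * I * (z * s + c) := by
      ring
    linear_combination ((c : ℂ) + s * I) * this + (z - I) * hu
  have e3 : normSq ((c : ℂ) + s * I) = 1 := by
    rw [normSq_add_mul_I, hcs]
  rw [anglePoissonKernel, e1, e2, ← Complex.normSq_eq_norm_sq, map_div₀, map_mul, map_mul, e3,
    map_mul, normSq_I]
  have : normSq (2 : ℂ) = 4 := by simp; norm_num
  rw [this]
  field_simp

lemma exists_halfPlane_poisson_measure {f : ℂ → ℂ}
    (hf : ∀ z : ℂ, 0 < z.im → DifferentiableAt ℂ f z) (him : ∀ z : ℂ, 0 < z.im → (f z).im < 0) :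
    ∃ σ : Measure ℝ, IsFiniteMeasure σ ∧ ∀ z : ℂ, 0 < z.im →
      -(f z).im = ∫ θ, z.im / normSq (z * Real.sin (θ / 2) + Real.cos (θ / 2)) ∂σ := by
  set C : ℂ → ℂ := fun w => I * (1 + w) / (1 - w) with hC
  have hne : ∀ w ∈ Metric.ball (0 : ℂ) 1, 1 - w ≠ 0 := fun w hw h => by
    rw [sub_eq_zero] at h
    simp [← h] at hw
  have hCim : ∀ w ∈ Metric.ball (0 : ℂ) 1, 0 < (C w).im := fun w hw => by
    have h0 := normSq_pos.2 (hne w hw)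
    have h1 : (C w).im = (1 - normSq w) / normSq (1 - w) := by
      simp only [hC, Complex.div_im]
      field_simp
      simp [normSq_apply]
      ring
    rw [h1]
    refine div_pos ?_ h0
    rw [mem_ball_zero_iff] at hw
    rw [normSq_eq_norm_sq]
    nlinarith [norm_nonneg w]
  have hv : DifferentiableOn ℂ (f ∘ C) (Metric.ball 0 1) := fun w hw => by
    refine DifferentiableAt.differentiableWithinAt ?_
    refine (hf _ (hCim w hw)).comp w ?_
    exact DifferentiableAt.div (by fun_prop) (by fun_prop) (hne w hw)
  obtain ⟨σ, hσ⟩ := exists_poisson_measure hv fun w hw => him _ (hCim w hw)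
  set m := (f (C 0)).im with hm
  have hm0 : m < 0 := him _ (hCim 0 (by simp))
  refine ⟨Real.toNNReal (-m) • (σ : Measure ℝ), inferInstance, fun z hz => ?_⟩
  have hzI : z + I ≠ 0 := fun h => by
    have := congrArg Complex.im h
    simp at this
    linarith
  have hw : ‖(z - I) / (z + I)‖ < 1 := by
    rw [norm_div, div_lt_one (norm_pos_iff.2 hzI), ← sq_lt_sq₀ (norm_nonneg _) (norm_nonneg _),
      ← normSq_eq_norm_sq, ← normSq_eq_norm_sq]
    simp [normSq_apply]
    nlinarith
  have hCz : C ((z - I) / (z + I)) = z := by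
    have h2 : 1 - (z - I) / (z + I) ≠ 0 := hne _ (by simpa using hw)
    simp only [hC]
    rw [div_eq_iff h2]
    field_simp
    ring
  have h := hσ _ hw
  simp only [Function.comp_apply, hCz, anglePoissonKernel_cayley hz] at h
  rw [integral_smul_nnreal_measure, h, ← hm, NNReal.smul_def, Real.coe_toNNReal _ (by linarith)]
  rw [smul_eq_mul, neg_mul, mul_inv_cancel_left₀ hm0.ne]

/-- The point of the real line with half-angle parameter `θ / 2`, i.e. the image of `e^{iθ}` under
the Cayley transform. -/
noncomputable def negCotHalf (θ : ℝ) : ℝ := -Real.cos (θ / 2) / Real.sin (θ / 2)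

lemma normSq_mul_I_mul_add (y s c : ℝ) : normSq (y * I * s + c) = y ^ 2 * s ^ 2 + c ^ 2 := by
  simp [normSq_apply]
  ring

lemma lintegral_inv_sin_sq_eq_one {f : ℂ → ℂ} (him : ∀ z : ℂ, 0 < z.im → (f z).im < 0)
    (hlim : Tendsto (fun y : ℝ => y * I * f (y * I)) atTop (𝓝 1)) {σ : Measure ℝ}
    (hσ : ∀ z : ℂ, 0 < z.im →
      -(f z).im = ∫ θ, z.im / normSq (z * Real.sin (θ / 2) + Real.cos (θ / 2)) ∂σ) :
    ∫⁻ θ, (ENNReal.ofReal (Real.sin (θ / 2) ^ 2))⁻¹ ∂σ = 1 := by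
  set g : ℕ → ℝ → ℝ := fun n θ => Real.sin (θ / 2) ^ 2 + Real.cos (θ / 2) ^ 2 / ((n : ℝ) + 1) ^ 2
    with hg
  have hgpos : ∀ n θ, 0 < g n θ := fun n θ => by
    have h1 := Real.sin_sq_add_cos_sq (θ / 2)
    rcases eq_or_ne (Real.sin (θ / 2)) 0 with h | h
    · have : Real.cos (θ / 2) ^ 2 = 1 := by rw [← h1, h]; ring
      simp only [hg, this]
      positivity
    · simp only [hg]
      positivity
  have hval : ∀ n : ℕ, ∫⁻ θ, (ENNReal.ofReal (g n θ))⁻¹ ∂σ =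
      ENNReal.ofReal ((((n + 1 : ℝ) : ℂ) * I * f ((n + 1 : ℝ) * I)).re) := fun n => by
    have hy : 0 < (n : ℝ) + 1 := by positivity
    have hyim : (((n + 1 : ℝ) : ℂ) * I).im = n + 1 := by simp
    have hre : (((n + 1 : ℝ) : ℂ) * I * f ((n + 1 : ℝ) * I)).re =
        (n + 1) * -(f ((n + 1 : ℝ) * I)).im := by
      rw [mul_assoc, re_ofReal_mul, I_mul_re]
    have h := hσ ((n + 1 : ℝ) * I) (by rwa [hyim])
    have hint : (((n + 1 : ℝ) : ℂ) * I * f ((n + 1 : ℝ) * I)).re = ∫ θ, (g n θ)⁻¹ ∂σ := by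
      rw [hre, h, ← integral_const_mul]
      refine integral_congr_ae (ae_of_all _ fun θ => ?_)
      have h3 := hgpos n θ
      simp only [hyim, normSq_mul_I_mul_add]
      have h4 : (n + 1 : ℝ) ^ 2 * Real.sin (θ / 2) ^ 2 + Real.cos (θ / 2) ^ 2 =
          (n + 1) ^ 2 * g n θ := by
        simp only [hg]
        field_simp
      rw [h4]
      field_simp
    have hpos : 0 < (((n + 1 : ℝ) : ℂ) * I * f ((n + 1 : ℝ) * I)).re := by
      rw [hre]
      exact mul_pos hy (neg_pos.2 (him _ (by rwa [hyim])))
    have hI : Integrable (fun θ => (g n θ)⁻¹) σ :=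
      Integrable.of_integral_ne_zero (by rw [← hint]; exact hpos.ne')
    rw [hint, ofReal_integral_eq_lintegral_ofReal hI
      (ae_of_all _ fun θ => (inv_pos.2 (hgpos n θ)).le)]
    exact lintegral_congr fun θ => (ENNReal.ofReal_inv_of_pos (hgpos n θ)).symm
  have hnat : Tendsto (fun n : ℕ => (n : ℝ) + 1) atTop atTop :=
    tendsto_atTop_add_const_right _ _ tendsto_natCast_atTop_atTop
  have hleft : Tendsto (fun n => ∫⁻ θ, (ENNReal.ofReal (g n θ))⁻¹ ∂σ) atTop (𝓝 1) := by
    simp only [hval]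
    have h := ((Complex.continuous_re.tendsto _).comp hlim).comp hnat
    rw [← ENNReal.ofReal_one, ← Complex.one_re]
    exact (ENNReal.continuous_ofReal.tendsto _).comp h
  refine tendsto_nhds_unique (lintegral_tendsto_of_tendsto_of_monotone (fun n => ?_)
    (ae_of_all _ fun θ m n hmn => ?_) (ae_of_all _ fun θ => ?_)) hleft
  · simp only [hg]
    exact Measurable.aemeasurable (by fun_prop)
  · simp only [hg]
    gcongr
  · refine (continuous_inv.tendsto _).comp ((ENNReal.continuous_ofReal.tendsto _).comp ?_)
    have h : Tendsto (fun n : ℕ => ((n : ℝ) + 1) ^ 2) atTop atTop :=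
      (tendsto_pow_atTop two_ne_zero).comp hnat
    simpa using (tendsto_const_nhds (x := Real.sin (θ / 2) ^ 2)).add
      (h.const_div_atTop (Real.cos (θ / 2) ^ 2))

lemma exists_im_cauchyTransform_eq {f : ℂ → ℂ}
    (hf : ∀ z : ℂ, 0 < z.im → DifferentiableAt ℂ f z) (him : ∀ z : ℂ, 0 < z.im → (f z).im < 0)
    (hlim : Tendsto (fun y : ℝ => y * I * f (y * I)) atTop (𝓝 1)) :
    ∃ ρ : Measure ℝ, IsProbabilityMeasure ρ ∧
      ∀ z : ℂ, 0 < z.im → (cauchyTransform ρ z).im = (f z).im := by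
  obtain ⟨σ, -, hσ⟩ := exists_halfPlane_poisson_measure hf him
  have hone := lintegral_inv_sin_sq_eq_one him hlim hσ
  set d : ℝ → ℝ≥0∞ := fun θ => (ENNReal.ofReal (Real.sin (θ / 2) ^ 2))⁻¹ with hd
  have hdm : Measurable d := by fun_prop
  have hT : Measurable negCotHalf := by unfold negCotHalf; fun_prop
  have hfin : ∀ᵐ θ ∂σ, d θ < ∞ := ae_lt_top hdm (by simp [hone])
  have : IsProbabilityMeasure (σ.withDensity d) :=
    ⟨by rw [withDensity_apply _ MeasurableSet.univ, Measure.restrict_univ, hone]⟩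
  have hρ : IsProbabilityMeasure ((σ.withDensity d).map negCotHalf) :=
    Measure.isProbabilityMeasure_map hT.aemeasurable
  refine ⟨_, hρ, fun z hz => neg_injective ?_⟩
  rw [neg_im_cauchyTransform _ hz.ne', hσ z hz, integral_map hT.aemeasurable
    (Measurable.aestronglyMeasurable (by fun_prop)),
    integral_withDensity_eq_integral_toReal_smul hdm hfin]
  refine integral_congr_ae (hfin.mono fun θ hθ => ?_)
  have hs : Real.sin (θ / 2) ≠ 0 := fun h => by simp [hd, h] at hθ
  have h : z * Real.sin (θ / 2) + Real.cos (θ / 2) =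
      Real.sin (θ / 2) * (z - negCotHalf θ) := by
    have : (Real.sin (θ / 2) : ℂ) ≠ 0 := ofReal_ne_zero.2 hs
    rw [negCotHalf]
    push_cast at this ⊢
    field_simp
    ring
  have h2 : normSq (z - negCotHalf θ) ≠ 0 := by
    simpa [normSq_eq_zero] using sub_ofReal_ne_zero hz.ne' (negCotHalf θ)
  simp only [h, map_mul, normSq_ofReal, hd, ENNReal.toReal_inv,
    ENNReal.toReal_ofReal (sq_nonneg (Real.sin (θ / 2))), smul_eq_mul]
  field_simp

/-- **Nevanlinna's characterization of Cauchy transforms** of probability measures. -/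
theorem exists_cauchyTransform_eq {f : ℂ → ℂ}
    (hf : ∀ z : ℂ, 0 < z.im → DifferentiableAt ℂ f z) (him : ∀ z : ℂ, 0 < z.im → (f z).im < 0)
    (hle : ∀ z : ℂ, 0 < z.im → ‖f z‖ ≤ z.im⁻¹)
    (hlim : Tendsto (fun y : ℝ => y * I * f (y * I)) atTop (𝓝 1)) :
    ∃ ρ : Measure ℝ, IsProbabilityMeasure ρ ∧ ∀ z : ℂ, 0 < z.im → cauchyTransform ρ z = f z := by
  obtain ⟨ρ, hρ, h⟩ := exists_im_cauchyTransform_eq hf him hlim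
  have hopen : IsOpen {z : ℂ | 0 < z.im} := isOpen_lt continuous_const Complex.continuous_im
  have hanal : AnalyticOnNhd ℂ (fun z => f z - cauchyTransform ρ z) {z : ℂ | 0 < z.im} :=
    DifferentiableOn.analyticOnNhd (fun z hz => ((hf z hz).sub
      (differentiableAt_cauchyTransform ρ hz)).differentiableWithinAt) hopen
  obtain ⟨c, hc⟩ := hanal.eq_const_of_im_eq_const (c₀ := 0) (fun z hz => by simp [h z hz])
    hopen ⟨⟨I, by simp⟩, (convex_halfSpace_im_gt 0).isPreconnected⟩
  have hc0 : ‖c‖ ≤ 0 := by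
    refine ge_of_tendsto' (x := atTop) (f := fun n : ℕ => 2 * ((n : ℝ) + 1)⁻¹) ?_ fun n => ?_
    · simpa using (tendsto_one_div_add_atTop_nhds_zero_nat (𝕜 := ℝ)).const_mul 2
    · have hy : 0 < (((n + 1 : ℝ) : ℂ) * I).im := by simp; positivity
      rw [← hc _ hy]
      refine (norm_sub_le _ _).trans ?_
      have h1 := hle _ hy
      have h2 := norm_cauchyTransform_le ρ hy
      simp only [mul_I_im, ofReal_re] at h1 h2
      linarith
  exact ⟨ρ, hρ, fun z hz => (sub_eq_zero.1 ((hc z hz).trans (norm_le_zero_iff.1 hc0))).symm⟩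

end Nevanlinna

section Subordination

/-- For `a, b` in the upper half-plane this says that the hyperbolic distance of `a` and `b` is at
most `2 arsinh (√c / 2)`. -/
def HypClose (c : ℝ) (a b : ℂ) : Prop := ‖a - b‖ ^ 2 ≤ c * (a.im * b.im)

lemma hypClose_self_div {a b : ℂ} (ha : 0 < a.im) (hb : 0 < b.im) :
    HypClose (‖a - b‖ ^ 2 / (a.im * b.im)) a b := by
  rw [HypClose, div_mul_cancel₀ _ (mul_pos ha hb).ne']

lemma HypClose.add {c : ℝ} (hc : 0 ≤ c) {a a' b b' : ℂ} (ha : HypClose c a a')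
    (hb : HypClose c b b') (ha0 : 0 ≤ a.im) (ha0' : 0 ≤ a'.im) (hb0 : 0 ≤ b.im)
    (hb0' : 0 ≤ b'.im) : HypClose c (a + b) (a' + b') := by
  unfold HypClose at *
  have h1 : ‖a + b - (a' + b')‖ ≤ ‖a - a'‖ + ‖b - b'‖ := by
    rw [add_sub_add_comm]; exact norm_add_le _ _
  have h2 : 2 * (‖a - a'‖ * ‖b - b'‖) ≤ c * (a.im * b'.im + b.im * a'.im) := by
    refine abs_le_of_sq_le_sq' ?_ (by positivity) |>.2
    have h3 := mul_le_mul ha hb (sq_nonneg _) (by positivity)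
    nlinarith [mul_nonneg (sq_nonneg c) (sq_nonneg (a.im * b'.im - b.im * a'.im))]
  calc ‖a + b - (a' + b')‖ ^ 2 ≤ (‖a - a'‖ + ‖b - b'‖) ^ 2 := by gcongr
    _ ≤ c * ((a + b).im * (a' + b').im) := by
      simp only [add_im]
      nlinarith

lemma HypClose.norm_le {c B : ℝ} (hc : 0 ≤ c) {a b : ℂ} (h : HypClose c a b) (ha : 0 ≤ a.im)
    (hb : ‖b‖ ≤ B) : ‖a‖ ≤ (2 + c) * B := by
  by_contra! hlt
  have hB : 0 ≤ B := (norm_nonneg b).trans hb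
  have h1 : ‖a‖ - B ≤ ‖a - b‖ := by linarith [norm_sub_norm_le a b]
  have h2 : a.im * b.im ≤ ‖a‖ * B := by
    have h3 := (le_abs_self _).trans (abs_im_le_norm a)
    have h4 := ((le_abs_self _).trans (abs_im_le_norm b)).trans hb
    exact (mul_le_mul_of_nonneg_left h4 ha).trans (mul_le_mul_of_nonneg_right h3 hB)
  have h5 : 0 ≤ ‖a‖ - B := by nlinarith
  have h6 : (‖a‖ - B) ^ 2 ≤ c * (‖a‖ * B) :=
    (pow_le_pow_left₀ h5 h1 2).trans (h.trans (by gcongr))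
  nlinarith [norm_nonneg a, mul_nonneg hc hB]

lemma IsSublinearPick.hypClose {h : ℂ → ℂ} (hh : IsSublinearPick h) {c : ℝ} {w w' : ℂ}
    (hw : 0 < w.im) (hw' : 0 < w'.im) (hc : HypClose c w w') : HypClose c (h w) (h w') := by
  have h1 := hh.schwarz_pick w w' hw hw'
  have h2 := mul_nonneg (hh.im_nonneg w hw) (hh.im_nonneg w' hw')
  have h3 := mul_pos hw hw'
  refine le_of_mul_le_mul_right (h1.trans ?_) h3
  calc _ ≤ c * (w.im * w'.im) * ((h w).im * (h w').im) := by gcongr; exact hc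
    _ = _ := by ring

lemma IsSublinearPick.norm_deriv_mul_im_le {h : ℂ → ℂ} (hh : IsSublinearPick h) {a : ℂ}
    (ha : 0 < a.im) : ‖deriv h a‖ * a.im ≤ (h a).im := by
  refine abs_le_of_sq_le_sq' ?_ (hh.im_nonneg a ha) |>.2
  have hd := (hh.differentiableAt a ha).hasDerivAt
  have hid : Tendsto (fun w : ℂ => w) (𝓝[≠] a) (𝓝 a) := tendsto_id.mono_left nhdsWithin_le_nhds
  have him : Tendsto Complex.im (𝓝[≠] a) (𝓝 a.im) := (Complex.continuous_im.tendsto a).comp hid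
  have hhim : Tendsto (fun w => (h w).im) (𝓝[≠] a) (𝓝 (h a).im) :=
    (Complex.continuous_im.tendsto _).comp (hd.continuousAt.tendsto.comp hid)
  have h1 := ((hasDerivAt_iff_tendsto_slope.1 hd).norm.pow 2).mul (him.mul_const a.im)
  have h2 := hhim.mul_const (h a).im
  have h3 := le_of_tendsto_of_tendsto h1 h2 (by
    filter_upwards [self_mem_nhdsWithin, him.eventually (lt_mem_nhds ha)] with w hwa hw
    have h4 := hh.schwarz_pick w a hw ha
    have h5 : 0 < ‖w - a‖ := norm_pos_iff.2 (sub_ne_zero.2 hwa)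
    rw [slope_def_field, norm_div, div_pow, div_mul_eq_mul_div, div_le_iff₀ (by positivity)]
    linarith)
  nlinarith

lemma IsSublinearPick.exists_norm_le {h : ℂ → ℂ} (hh : IsSublinearPick h) {ε : ℝ} (h0 : 0 < ε)
    (h1 : ε ≤ 1 / 2) : ∃ R > 0, ∀ Y : ℝ, R ≤ Y → ∀ w : ℂ, ‖w - Y * I‖ ≤ ε * Y → ‖h w‖ ≤ ε * Y := by
  obtain ⟨R, hR, hbd⟩ := hh.sublinear (ε / 2) (by positivity)
  refine ⟨2 * R, by positivity, fun Y hY w hw => ?_⟩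
  have hY0 : 0 < Y := by linarith
  have h2 : ‖w - Y * I‖ ≤ Y / 2 := hw.trans (by nlinarith)
  have h3 : |w.im - Y| ≤ Y / 2 := by simpa using (abs_im_le_norm (w - Y * I)).trans h2
  have h4 : ‖w‖ ≤ 3 / 2 * Y := by
    have := norm_sub_norm_le w (Y * I)
    rw [norm_mul, norm_I, mul_one, Complex.norm_of_nonneg hY0.le] at this
    linarith
  have h5 := (abs_le.1 h3).1
  refine (hbd w (by linarith) (by linarith)).trans ?_
  nlinarith

/-- The map whose fixed points in the upper half-plane are the values at `z` of the first
subordination function of the pair `H`, `K`. -/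
def subordinationMap (H K : ℂ → ℂ) (z w : ℂ) : ℂ := z + K (z + H w)

/-- The first subordination function of the pair `H`, `K`. -/
noncomputable def subordination (H K : ℂ → ℂ) (z : ℂ) : ℂ :=
  limUnder atTop fun k : ℕ => (subordinationMap H K z)^[k] z

variable {H K : ℂ → ℂ} {z w w' : ℂ} {c : ℝ}

lemma IsSublinearPick.le_im_add (hH : IsSublinearPick H) (hw : 0 < w.im) (z : ℂ) :
    z.im ≤ (z + H w).im := by
  rw [add_im]
  exact le_add_of_nonneg_right (hH.im_nonneg w hw)

lemma le_im_subordinationMap (hH : IsSublinearPick H) (hK : IsSublinearPick K) (hz : 0 < z.im)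
    (hw : 0 < w.im) : z.im ≤ (subordinationMap H K z w).im :=
  hK.le_im_add (hz.trans_le (hH.le_im_add hw z)) z

lemma le_im_iterate_subordinationMap (hH : IsSublinearPick H) (hK : IsSublinearPick K)
    (hz : 0 < z.im) (k : ℕ) : z.im ≤ ((subordinationMap H K z)^[k] z).im := by
  induction k with
  | zero => rfl
  | succ k ih =>
    rw [Function.iterate_succ_apply']
    exact le_im_subordinationMap hH hK hz (hz.trans_le ih)

lemma norm_subordinationMap_sub_sq_le (hH : IsSublinearPick H) (hK : IsSublinearPick K)
    (hz : 0 < z.im) (hw : 0 < w.im) (hw' : 0 < w'.im) (hc : 0 ≤ c) (h : HypClose c w w') :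
    ‖subordinationMap H K z w - subordinationMap H K z w'‖ ^ 2 ≤
      c * (((subordinationMap H K z w).im - z.im) * ((subordinationMap H K z w').im - z.im)) := by
  have h0 : HypClose c z z := by simpa [HypClose] using mul_nonneg hc (mul_self_nonneg z.im)
  have h1 := h0.add hc (hH.hypClose hw hw' h) hz.le hz.le (hH.im_nonneg w hw) (hH.im_nonneg w' hw')
  have h2 := hK.hypClose (hz.trans_le (hH.le_im_add hw z)) (hz.trans_le (hH.le_im_add hw' z)) h1
  simpa [subordinationMap, HypClose] using h2

lemma HypClose.subordinationMap (hH : IsSublinearPick H) (hK : IsSublinearPick K) {z' : ℂ}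
    (hz : 0 < z.im) (hz' : 0 < z'.im) (hw : 0 < w.im) (hw' : 0 < w'.im) (hc : 0 ≤ c)
    (h : HypClose c z z') (h' : HypClose c w w') :
    HypClose c (subordinationMap H K z w) (subordinationMap H K z' w') := by
  have hu := hz.trans_le (hH.le_im_add hw z)
  have hu' := hz'.trans_le (hH.le_im_add hw' z')
  have h1 := h.add hc (hH.hypClose hw hw' h') hz.le hz'.le (hH.im_nonneg w hw)
    (hH.im_nonneg w' hw')
  exact h.add hc (hK.hypClose hu hu' h1) hz.le hz'.le (hK.im_nonneg _ hu) (hK.im_nonneg _ hu')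

lemma HypClose.iterate_subordinationMap (hH : IsSublinearPick H) (hK : IsSublinearPick K) {z' : ℂ}
    (hz : 0 < z.im) (hz' : 0 < z'.im) (hc : 0 ≤ c) (h : HypClose c z z') (k : ℕ) :
    HypClose c ((_root_.subordinationMap H K z)^[k] z)
      ((_root_.subordinationMap H K z')^[k] z') := by
  induction k with
  | zero => exact h
  | succ k ih =>
    rw [Function.iterate_succ_apply', Function.iterate_succ_apply']
    exact HypClose.subordinationMap hH hK hz hz'
      (hz.trans_le (le_im_iterate_subordinationMap hH hK hz k))
      (hz'.trans_le (le_im_iterate_subordinationMap hH hK hz' k)) hc h ih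

lemma exists_norm_iterate_sub_le (hH : IsSublinearPick H) (hK : IsSublinearPick K) {ε : ℝ}
    (h0 : 0 < ε) (h1 : ε ≤ 1 / 2) : ∃ R > 0, ∀ Y : ℝ, R ≤ Y → ∀ k : ℕ,
      ‖(subordinationMap H K (Y * I))^[k] (Y * I) - Y * I‖ ≤ ε * Y := by
  obtain ⟨R₁, hR₁, hH'⟩ := hH.exists_norm_le h0 h1
  obtain ⟨R₂, hR₂, hK'⟩ := hK.exists_norm_le h0 h1
  refine ⟨max R₁ R₂, lt_max_of_lt_left hR₁, fun Y hY k => ?_⟩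
  have hY1 := (le_max_left _ _).trans hY
  have hY2 := (le_max_right _ _).trans hY
  induction k with
  | zero =>
    rw [Function.iterate_zero_apply, sub_self, norm_zero]
    exact mul_nonneg h0.le (hR₁.le.trans hY1)
  | succ k ih =>
    rw [Function.iterate_succ_apply', subordinationMap, add_sub_cancel_left]
    refine hK' Y hY2 _ ?_
    rw [add_sub_cancel_left]
    exact hH' Y hY1 _ ih

lemma exists_norm_iterate_le (hH : IsSublinearPick H) (hK : IsSublinearPick K) (hz : 0 < z.im) :
    ∃ M, ∀ k : ℕ, ‖(subordinationMap H K z)^[k] z‖ ≤ M := by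
  obtain ⟨R, hR, hbd⟩ := exists_norm_iterate_sub_le hH hK one_half_pos le_rfl
  have hR' : 0 < ((R : ℂ) * I).im := by simpa using hR
  have hc : 0 ≤ ‖z - R * I‖ ^ 2 / (z.im * ((R : ℂ) * I).im) := by positivity
  refine ⟨_, fun k => HypClose.norm_le hc
    (HypClose.iterate_subordinationMap hH hK hz hR' hc (hypClose_self_div hz hR') k)
    (hz.le.trans (le_im_iterate_subordinationMap hH hK hz k)) (B := 3 / 2 * R) ?_⟩
  have h1 := hbd R le_rfl k
  have h2 := norm_sub_norm_le ((subordinationMap H K (R * I))^[k] (R * I)) (R * I)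
  rw [norm_mul, norm_I, mul_one, Complex.norm_of_nonneg hR.le] at h2
  linarith

lemma cauchySeq_iterate_subordinationMap (hH : IsSublinearPick H) (hK : IsSublinearPick K)
    (hz : 0 < z.im) : CauchySeq fun k : ℕ => (subordinationMap H K z)^[k] z := by
  obtain ⟨M, hM⟩ := exists_norm_iterate_le hH hK hz
  set u : ℕ → ℂ := fun k => (subordinationMap H K z)^[k] z with hu
  have hsucc : ∀ k, u (k + 1) = subordinationMap H K z (u k) := fun k =>
    Function.iterate_succ_apply' _ _ _
  have him : ∀ k, z.im ≤ (u k).im := le_im_iterate_subordinationMap hH hK hz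
  have him0 : ∀ k, 0 < (u k).im := fun k => hz.trans_le (him k)
  have himM : ∀ k, (u k).im ≤ M := fun k =>
    ((le_abs_self _).trans (abs_im_le_norm _)).trans (hM k)
  have hM0 : 0 < M := (him0 0).trans_le (himM 0)
  set q := 1 - z.im / M with hq
  have hq1 : q < 1 := sub_lt_self _ (by positivity)
  have hq0 : 0 ≤ q := sub_nonneg.2 ((div_le_one hM0).2 ((him 0).trans (himM 0)))
  have hshrink : ∀ k, (u k).im - z.im ≤ q * (u k).im := fun k => by
    have : z.im / M * (u k).im ≤ z.im := by
      rw [div_mul_eq_mul_div, div_le_iff₀ hM0]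
      exact mul_le_mul_of_nonneg_left (himM k) hz.le
    rw [hq]
    linarith
  set c := ‖u 0 - u 1‖ ^ 2 / ((u 0).im * (u 1).im) with hc
  have hc0 : 0 ≤ c := div_nonneg (sq_nonneg _) (mul_pos (him0 0) (him0 1)).le
  have hclose : ∀ k, HypClose (c * (q ^ k) ^ 2) (u k) (u (k + 1)) := fun k => by
    induction k with
    | zero => simpa using hypClose_self_div (him0 0) (him0 1)
    | succ k ih =>
      have h := norm_subordinationMap_sub_sq_le hH hK hz (him0 k) (him0 (k + 1)) (by positivity) ih
      rw [← hsucc, ← hsucc] at h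
      refine h.trans ?_
      calc _ ≤ c * (q ^ k) ^ 2 * ((q * (u (k + 1)).im) * (q * (u (k + 1 + 1)).im)) := by
            gcongr
            · exact sub_nonneg.2 (him _)
            · exact mul_nonneg hq0 (him0 _).le
            · exact hshrink _
            · exact hshrink _
        _ = _ := by ring
  refine cauchySeq_of_le_geometric q (Real.sqrt c * M) hq1 fun k => ?_
  rw [dist_eq_norm]
  refine abs_le_of_sq_le_sq' ((hclose k).trans ?_) (by positivity) |>.2
  calc _ ≤ c * (q ^ k) ^ 2 * (M * M) := by
        gcongr
        · exact (him0 _).le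
        · exact himM _
        · exact himM _
    _ = Real.sqrt c ^ 2 * (q ^ k) ^ 2 * (M * M) := by rw [Real.sq_sqrt hc0]
    _ = _ := by ring

lemma tendsto_iterate_subordinationMap (hH : IsSublinearPick H) (hK : IsSublinearPick K)
    (hz : 0 < z.im) :
    Tendsto (fun k : ℕ => (subordinationMap H K z)^[k] z) atTop (𝓝 (subordination H K z)) :=
  (cauchySeq_iterate_subordinationMap hH hK hz).tendsto_limUnder

lemma le_im_subordination (hH : IsSublinearPick H) (hK : IsSublinearPick K) (hz : 0 < z.im) :
    z.im ≤ (subordination H K z).im :=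
  ge_of_tendsto' ((Complex.continuous_im.tendsto _).comp
    (tendsto_iterate_subordinationMap hH hK hz)) (le_im_iterate_subordinationMap hH hK hz)

lemma subordinationMap_subordination (hH : IsSublinearPick H) (hK : IsSublinearPick K)
    (hz : 0 < z.im) : subordinationMap H K z (subordination H K z) = subordination H K z := by
  have ht := tendsto_iterate_subordinationMap hH hK hz
  have him := hz.trans_le (le_im_subordination hH hK hz)
  have hHc := (hH.differentiableAt _ him).continuousAt
  have hKc := (hK.differentiableAt _ (hz.trans_le (hH.le_im_add him z))).continuousAt
  have hc : ContinuousAt (subordinationMap H K z) (subordination H K z) :=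
    continuousAt_const.add (ContinuousAt.comp (f := fun w => z + H w) hKc
      (continuousAt_const.add hHc))
  refine tendsto_nhds_unique (hc.tendsto.comp ht) ?_
  refine ((tendsto_add_atTop_iff_nat 1).2 ht).congr fun k => ?_
  exact Function.iterate_succ_apply' _ _ _

lemma eq_of_subordinationMap_eq (hH : IsSublinearPick H) (hK : IsSublinearPick K) (hz : 0 < z.im)
    (hw : 0 < w.im) (hw' : 0 < w'.im) (h : subordinationMap H K z w = w)
    (h' : subordinationMap H K z w' = w') : w = w' := by
  by_contra hne
  have hpos : 0 < ‖w - w'‖ ^ 2 := pow_pos (norm_pos_iff.2 (sub_ne_zero.2 hne)) 2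
  have h1 := norm_subordinationMap_sub_sq_le hH hK hz hw hw' (by positivity)
    (hypClose_self_div hw hw')
  have h2 := le_im_subordinationMap hH hK hz hw
  have h3 := le_im_subordinationMap hH hK hz hw'
  rw [h, h', div_mul_eq_mul_div, le_div_iff₀ (mul_pos hw hw')] at h1
  rw [h] at h2
  rw [h'] at h3
  have h4 := le_of_mul_le_mul_left h1 hpos
  nlinarith

/-- The second subordination function is the first one with the roles of `H`, `K` exchanged. -/
lemma subordination_swap (hH : IsSublinearPick H) (hK : IsSublinearPick K) (hz : 0 < z.im) :
    subordination K H z = z + H (subordination H K z) := by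
  have him := hz.trans_le (le_im_subordination hH hK hz)
  refine eq_of_subordinationMap_eq hK hH hz (hz.trans_le (le_im_subordination hK hH hz))
    (hz.trans_le (hH.le_im_add him z)) (subordinationMap_subordination hK hH hz) ?_
  have h := subordinationMap_subordination hH hK hz
  rw [subordinationMap] at h ⊢
  rw [h]

lemma HypClose.subordination (hH : IsSublinearPick H) (hK : IsSublinearPick K) {z' : ℂ}
    (hz : 0 < z.im) (hz' : 0 < z'.im) (hc : 0 ≤ c) (h : HypClose c z z') :
    HypClose c (subordination H K z) (_root_.subordination H K z') := by
  have ht := tendsto_iterate_subordinationMap hH hK hz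
  have ht' := tendsto_iterate_subordinationMap hH hK hz'
  have hi := fun a : ℂ => Complex.continuous_im.tendsto a
  exact le_of_tendsto_of_tendsto' ((ht.sub ht').norm.pow 2)
    ((((hi _).comp ht).mul ((hi _).comp ht')).const_mul c)
    (HypClose.iterate_subordinationMap hH hK hz hz' hc h)

lemma continuousAt_subordination (hH : IsSublinearPick H) (hK : IsSublinearPick K)
    (hz : 0 < z.im) : ContinuousAt (subordination H K) z := by
  set m := (subordination H K z).im
  have hm : 0 < m := hz.trans_le (le_im_subordination hH hK hz)
  set d : ℂ → ℝ := fun w => ‖w - z‖ ^ 2 / (w.im * z.im) with hd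
  have hdc : ContinuousAt d z := by
    refine ContinuousAt.div (by fun_prop) ?_ (mul_pos hz hz).ne'
    exact (Complex.continuous_im.mul continuous_const).continuousAt
  have hd0 : Tendsto d (𝓝 z) (𝓝 0) := by simpa [hd] using hdc.tendsto
  have hbound : ∀ᶠ w in 𝓝 z, ‖subordination H K w - subordination H K z‖ ^ 2 ≤
      2 * d w * m ^ 2 + d w ^ 2 * m ^ 2 := by
    filter_upwards [(Complex.continuous_im.tendsto z).eventually (lt_mem_nhds hz)] with w hw
    have hdw : 0 ≤ d w := by simp only [hd]; positivity
    have h := HypClose.subordination hH hK hw hz hdw (hypClose_self_div hw hz)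
    rw [HypClose] at h
    set D := ‖subordination H K w - subordination H K z‖
    have h1 : (subordination H K w).im ≤ m + D := by
      have := (le_abs_self _).trans (abs_im_le_norm
        (subordination H K w - subordination H K z))
      rw [sub_im] at this
      linarith
    have h2 : D ^ 2 ≤ d w * ((m + D) * m) := h.trans (by gcongr)
    nlinarith [sq_nonneg (D - d w * m)]
  have hlim : Tendsto (fun w => 2 * d w * m ^ 2 + d w ^ 2 * m ^ 2) (𝓝 z) (𝓝 0) := by
    simpa using ((hd0.const_mul 2).mul_const (m ^ 2)).add ((hd0.pow 2).mul_const (m ^ 2))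
  have hsq := squeeze_zero' (Eventually.of_forall fun w => sq_nonneg _) hbound hlim
  rw [ContinuousAt, tendsto_iff_norm_sub_tendsto_zero]
  simpa using hsq.sqrt

lemma differentiableAt_subordination (hH : IsSublinearPick H) (hK : IsSublinearPick K)
    (hz : 0 < z.im) : DifferentiableAt ℂ (subordination H K) z := by
  set ω := subordination H K with hω
  set a := ω z
  set b := z + H a with hb
  have hza : z.im ≤ a.im := le_im_subordination hH hK hz
  have ha : 0 < a.im := hz.trans_le hza
  have hzb : z.im ≤ b.im := hH.le_im_add ha z
  have hab : z + K b = a := subordinationMap_subordination hH hK hz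
  have hne : 1 - deriv H a * deriv K b ≠ 0 := fun h => by
    have h1 : ‖deriv H a‖ * ‖deriv K b‖ = 1 := by
      rw [← norm_mul, ← sub_eq_zero.1 h, norm_one]
    have h2 := hH.norm_deriv_mul_im_le ha
    have h3 := hK.norm_deriv_mul_im_le (hz.trans_le hzb)
    have h4 : (H a).im = b.im - z.im := by simp [hb]
    have h5 : (K b).im = a.im - z.im := by rw [← hab]; simp
    have h6 := mul_le_mul h2 h3 (mul_nonneg (norm_nonneg _) (hz.trans_le hzb).le)
      (hH.im_nonneg a ha)
    rw [h4, h5, mul_mul_mul_comm, h1] at h6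
    nlinarith
  have hωc : Tendsto ω (𝓝 z) (𝓝 a) := continuousAt_subordination hH hK hz
  have hHc := (hH.differentiableAt a ha).continuousAt
  have hω' : Tendsto (fun w => w + H (ω w)) (𝓝 z) (𝓝 b) := tendsto_id.add (hHc.tendsto.comp hωc)
  have hα : Tendsto (fun w => dslope H a (ω w)) (𝓝 z) (𝓝 (deriv H a)) := by
    rw [← dslope_same]
    exact (continuousAt_dslope_same.2 (hH.differentiableAt a ha)).tendsto.comp hωc
  have hβ : Tendsto (fun w => dslope K b (w + H (ω w))) (𝓝 z) (𝓝 (deriv K b)) := by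
    rw [← dslope_same]
    exact (continuousAt_dslope_same.2
      (hK.differentiableAt b (hz.trans_le hzb))).tendsto.comp hω'
  have hden := (tendsto_const_nhds (x := (1 : ℂ))).sub (hα.mul hβ)
  have hquot := (((tendsto_const_nhds (x := (1 : ℂ))).add hβ).div hden hne).mono_left
    (nhdsWithin_le_nhds (s := {z}ᶜ))
  refine (hasDerivAt_iff_tendsto_slope.2 (hquot.congr' ?_)).differentiableAt
  filter_upwards [self_mem_nhdsWithin,
    nhdsWithin_le_nhds (hden.eventually_ne hne),
    nhdsWithin_le_nhds ((Complex.continuous_im.tendsto z).eventually (lt_mem_nhds hz))]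
    with w hwz hw hw0
  have h1 := sub_smul_dslope H a (ω w)
  have h2 := sub_smul_dslope K b (w + H (ω w))
  have h3 : w + K (w + H (ω w)) = ω w := subordinationMap_subordination hH hK hw0
  have h4 : w - z ≠ 0 := sub_ne_zero.2 hwz
  simp only [Pi.div_apply, smul_eq_mul] at h1 h2 ⊢
  rw [slope_def_field, div_eq_div_iff hw h4]
  linear_combination dslope K b (w + H (ω w)) * h1 + h2 + h3 - hab

lemma tendsto_subordination_div (hH : IsSublinearPick H) (hK : IsSublinearPick K) :
    Tendsto (fun y : ℝ => subordination H K (y * I) / (y * I)) atTop (𝓝 1) := by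
  rw [Metric.tendsto_atTop]
  intro ε hε
  obtain ⟨R, hR, h⟩ := exists_norm_iterate_sub_le hH hK (ε := min (ε / 2) (1 / 2))
    (by positivity) (min_le_right _ _)
  refine ⟨R, fun Y hY => ?_⟩
  have hY0 : 0 < Y := hR.trans_le hY
  have ht := tendsto_iterate_subordinationMap hH hK (z := Y * I) (by simpa using hY0)
  have h1 := le_of_tendsto' (ht.sub_const (Y * I)).norm (h Y hY)
  have hYI : (Y : ℂ) * I ≠ 0 := by simpa using hY0.ne'
  rw [dist_eq_norm, div_sub_one hYI, norm_div, div_lt_iff₀ (norm_pos_iff.2 hYI), norm_mul, norm_I,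
    mul_one, Complex.norm_of_nonneg hY0.le]
  have h2 := min_le_left (ε / 2) (1 / 2)
  nlinarith

end Subordination

lemma exists_reciprocalCauchyTransform_eq_subordination {H K : ℂ → ℂ} (hH : IsSublinearPick H)
    (hK : IsSublinearPick K) : ∃ ρ : Measure ℝ, IsProbabilityMeasure ρ ∧
      ∀ z : ℂ, 0 < z.im → reciprocalCauchyTransform ρ z = subordination H K z := by
  have him : ∀ z : ℂ, 0 < z.im → z.im ≤ (subordination H K z).im := fun z hz =>
    le_im_subordination hH hK hz
  have hne : ∀ z : ℂ, 0 < z.im → subordination H K z ≠ 0 := fun z hz h => by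
    have := him z hz
    rw [h, zero_im] at this
    linarith
  obtain ⟨ρ, hρ, h⟩ := exists_cauchyTransform_eq (f := fun z => (subordination H K z)⁻¹)
    (fun z hz => (differentiableAt_subordination hH hK hz).inv (hne z hz))
    (fun z hz => by
      rw [inv_im]
      exact div_neg_of_neg_of_pos (neg_lt_zero.2 (hz.trans_le (him z hz)))
        (normSq_pos.2 (hne z hz)))
    (fun z hz => by
      rw [norm_inv]
      exact inv_anti₀ hz ((him z hz).trans ((le_abs_self _).trans (abs_im_le_norm _))))
    (by
      have h := (tendsto_subordination_div hH hK).inv₀ one_ne_zero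
      simpa [div_eq_mul_inv, mul_comm, mul_assoc] using h)
  exact ⟨ρ, hρ, fun z hz => by rw [reciprocalCauchyTransform, h z hz, inv_inv]⟩

lemma eq_of_reciprocalCauchyTransform_eq {ρ σ : Measure ℝ} [IsProbabilityMeasure ρ]
    [IsProbabilityMeasure σ]
    (h : ∀ z : ℂ, 0 < z.im → reciprocalCauchyTransform ρ z = reciprocalCauchyTransform σ z) :
    ρ = σ :=
  eq_of_cauchyTransform_eq fun z hz => inv_injective (h z hz)

lemma reciprocalCauchyTransform_im_pos (ρ : Measure ℝ) [IsProbabilityMeasure ρ] {z : ℂ}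
    (hz : 0 < z.im) : 0 < (reciprocalCauchyTransform ρ z).im := by
  rw [reciprocalCauchyTransform, inv_im]
  exact div_pos (neg_pos.2 (cauchyTransform_im_neg ρ hz))
    (normSq_pos.2 (cauchyTransform_ne_zero ρ hz))

end Auxiliary

/-- Decomposition of the additive free convolution into monotone/boolean pieces: for
probability measures `μ, ν` on `ℝ` there exists a unique pair `(ζ₁, ζ₂)` of probability
measures with `F_μ(F_{ζ₁}(z)) = F_ν(F_{ζ₂}(z)) = F_{ζ₁}(z) + F_{ζ₂}(z) − z` on the upper
half-plane; consequently `μ ⊞ ν = μ ▷ ζ₁ = ν ▷ ζ₂ = ζ₁ ⊎ ζ₂`. -/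
theorem free_convolution_subordination_exists_unique
    (μ ν : Measure ℝ) [IsProbabilityMeasure μ] [IsProbabilityMeasure ν] :
    ∃! p : Measure ℝ × Measure ℝ,
      IsProbabilityMeasure p.1 ∧ IsProbabilityMeasure p.2 ∧
      ∀ z : ℂ, 0 < z.im →
        reciprocalCauchyTransform μ (reciprocalCauchyTransform p.1 z)
            = reciprocalCauchyTransform ν (reciprocalCauchyTransform p.2 z) ∧
        reciprocalCauchyTransform ν (reciprocalCauchyTransform p.2 z)
            = reciprocalCauchyTransform p.1 z + reciprocalCauchyTransform p.2 z - z := by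
  have hH := isSublinearPick_reciprocal_sub_self μ
  have hK := isSublinearPick_reciprocal_sub_self ν
  set H : ℂ → ℂ := fun w => reciprocalCauchyTransform μ w - w with hHdef
  set K : ℂ → ℂ := fun w => reciprocalCauchyTransform ν w - w with hKdef
  obtain ⟨ζ₁, hζ₁, h₁⟩ := exists_reciprocalCauchyTransform_eq_subordination hH hK
  obtain ⟨ζ₂, hζ₂, h₂⟩ := exists_reciprocalCauchyTransform_eq_subordination hK hH
  refine ⟨(ζ₁, ζ₂), ⟨hζ₁, hζ₂, fun z hz => ?_⟩, ?_⟩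
  · have e₁ := subordination_swap hH hK hz
    have e₂ := subordination_swap hK hH hz
    simp only [hHdef] at e₁
    simp only [hKdef] at e₂
    rw [h₁ z hz, h₂ z hz]
    constructor
    · linear_combination e₂ - e₁
    · linear_combination -e₂
  · rintro ⟨ξ₁, ξ₂⟩ ⟨hξ₁, hξ₂, h⟩
    simp only at hξ₁ hξ₂ h
    have key : ∀ z : ℂ, 0 < z.im → reciprocalCauchyTransform ξ₁ z = subordination H K z ∧
        reciprocalCauchyTransform ξ₂ z = subordination K H z := fun z hz => by
      obtain ⟨h3, h4⟩ := h z hz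
      have e₁ : z + H (reciprocalCauchyTransform ξ₁ z) = reciprocalCauchyTransform ξ₂ z := by
        simp only [hHdef]
        linear_combination h3 + h4
      have e₂ : z + K (reciprocalCauchyTransform ξ₂ z) = reciprocalCauchyTransform ξ₁ z := by
        simp only [hKdef]
        linear_combination h4
      constructor
      · exact eq_of_subordinationMap_eq hH hK hz (reciprocalCauchyTransform_im_pos ξ₁ hz)
          (hz.trans_le (le_im_subordination hH hK hz)) (by rw [subordinationMap, e₁, e₂])
          (subordinationMap_subordination hH hK hz)
      · exact eq_of_subordinationMap_eq hK hH hz (reciprocalCauchyTransform_im_pos ξ₂ hz)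
          (hz.trans_le (le_im_subordination hK hH hz)) (by rw [subordinationMap, e₂, e₁])
          (subordinationMap_subordination hK hH hz)
    refine Prod.ext ?_ ?_
    · exact eq_of_reciprocalCauchyTransform_eq fun z hz => by rw [(key z hz).1, h₁ z hz]
    · exact eq_of_reciprocalCauchyTransform_eq fun z hz => by rw [(key z hz).2, h₂ z hz]
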